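/- Let X be a finite connected graph in which every vertex x has valency k_x + 1 at least 3 (so k_x ≥ 2). Let ℓ be a normalized length function on X (so Σ_{e∈E} ℓ(e) = 2), let h > 0, and suppose there is a vector (x_e)_{e∈E} with all entries positive satisfying x_e = Σ_{f∈E} ρ_{ef} e^{−h ℓ(f)} x_f for all e ∈ E. Then h = (1/2) Σ_{x∈V} (k_x + 1) log k_x holds if and only if ℓ(e) = log(k_{i(e)} k_{t(e)}) / Σ_{x∈V} (k_x + 1) log k_x for every e ∈ E. -/

import Mathlib

/-- A finite graph in the sense of Serre: oriented edges with a fixed-point-free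
involution `bar`, and initial/terminal vertex maps `i`, `t`. -/
structure SerreGraph (V E : Type) where
  bar : E → E
  bar_bar : ∀ e, bar (bar e) = e
  bar_ne : ∀ e, bar e ≠ e
  i : E → V
  t : E → V
  i_bar : ∀ e, i (bar e) = t e
  t_bar : ∀ e, t (bar e) = i e

namespace SerreGraph

variable {V E : Type}

/-- `rho G e f = 1` iff `ef` is a combinatorial path without backtracking. -/
def rho [DecidableEq V] [DecidableEq E] (G : SerreGraph V E) (e f : E) : ℝ :=
  if G.t e = G.i f ∧ G.bar e ≠ f then 1 else 0

/-- The edge adjacency matrix of the graph. -/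
def adjMatrix [DecidableEq V] [DecidableEq E] (G : SerreGraph V E) : Matrix E E ℝ :=
  fun e f => G.rho e f

/-- The valency of a vertex: the number of edges with initial vertex `x`. -/
noncomputable def valency (G : SerreGraph V E) (x : V) : ℕ :=
  Nat.card {e : E // G.i e = x}

/-- `G.k x` is the valency of `x` minus one. -/
noncomputable def k (G : SerreGraph V E) (x : V) : ℕ :=
  G.valency x - 1

/-- The graph is connected: the equivalence relation on vertices generated by
relating `i e` to `t e` has a single class. -/
def Connected (G : SerreGraph V E) : Prop :=
  ∀ x y : V, Relation.EqvGen (fun a b => ∃ e : E, G.i e = a ∧ G.t e = b) x y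

/-- A nonnegative square matrix is reducible if the index set splits into two
nonempty complementary subsets with all entries between them vanishing. -/
def MatReducible (M : Matrix E E ℝ) : Prop :=
  ∃ U : Set E, U.Nonempty ∧ Uᶜ.Nonempty ∧ ∀ u ∈ U, ∀ v ∈ Uᶜ, M u v = 0 ∧ M v u = 0

/-- A matrix is irreducible if it is not reducible. -/
def MatIrreducible (M : Matrix E E ℝ) : Prop :=
  ¬ MatReducible M

/-- A length function: positive and invariant under the edge involution. -/
def IsLengthFunction (G : SerreGraph V E) (ℓ : E → ℝ) : Prop :=
  (∀ e, 0 < ℓ e) ∧ ∀ e, ℓ (G.bar e) = ℓ e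

end SerreGraph

namespace SerreGraph

section Basic

variable {V E : Type} (G : SerreGraph V E)

lemma rho_nonneg [DecidableEq V] [DecidableEq E] (e f : E) : 0 ≤ G.rho e f := by
  unfold rho; split_ifs <;> norm_num

lemma rho_eq_one [DecidableEq V] [DecidableEq E] {e f : E} (h₁ : G.t e = G.i f)
    (h₂ : G.bar e ≠ f) : G.rho e f = 1 :=
  if_pos ⟨h₁, h₂⟩

lemma rho_bar_bar [DecidableEq V] [DecidableEq E] (e f : E) :
    G.rho (G.bar f) (G.bar e) = G.rho e f := by
  unfold rho
  rw [G.t_bar, G.i_bar, G.bar_bar]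
  exact if_congr (and_congr eq_comm ne_comm) rfl rfl

lemma valency_eq_card [Fintype E] [DecidableEq V] (x : V) :
    G.valency x = (Finset.univ.filter fun e => G.i e = x).card := by
  rw [valency, Nat.card_eq_fintype_card, Fintype.card_subtype]

lemma two_le_k (hval : ∀ x : V, 3 ≤ G.valency x) (x : V) : (2 : ℝ) ≤ G.k x := by
  have := hval x
  have : 2 ≤ G.k x := by unfold k; omega
  exact_mod_cast this

lemma sum_log_k [Fintype V] [Fintype E] [DecidableEq V]
    (hval : ∀ x : V, 3 ≤ G.valency x) :
    ∑ e, Real.log (G.k (G.t e)) = ∑ x : V, ((G.k x : ℝ) + 1) * Real.log (G.k x) := by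
  have hbar : Function.Involutive G.bar := G.bar_bar
  rw [← Equiv.sum_comp hbar.toPerm]
  simp only [Function.Involutive.coe_toPerm, G.t_bar]
  rw [← Finset.sum_fiberwise_of_maps_to (g := G.i) (t := Finset.univ) (by simp)]
  refine Finset.sum_congr rfl fun x _ => ?_
  have hk : (G.k x : ℝ) + 1 = G.valency x := by
    have := hval x
    have : G.k x + 1 = G.valency x := by unfold k; omega
    exact_mod_cast this
  rw [hk, valency_eq_card, ← nsmul_eq_mul, ← Finset.sum_const]
  exact Finset.sum_congr rfl fun e he => by rw [(Finset.mem_filter.1 he).2]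

end Basic

section Weights

variable {V E : Type} [Fintype E] [DecidableEq V] [DecidableEq E] (G : SerreGraph V E)

/-- The rows of the edge adjacency matrix sum to `k` of the terminal vertex. -/
lemma sum_rho_right (e : E) : ∑ f, G.rho e f = G.k (G.t e) := by
  have hset : (Finset.univ.filter fun f => G.t e = G.i f ∧ G.bar e ≠ f)
      = (Finset.univ.filter fun f => G.i f = G.t e).erase (G.bar e) := by
    ext f; simp only [Finset.mem_filter, Finset.mem_erase, Finset.mem_univ, true_and]
    rw [eq_comm, ne_comm, and_comm]
  simp only [rho]
  rw [Finset.sum_boole, hset, Finset.card_erase_of_mem (by simp [G.i_bar]), k, valency_eq_card]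

/-- The columns of the edge adjacency matrix sum to `k` of the initial vertex. -/
lemma sum_rho_left (f : E) : ∑ e, G.rho e f = G.k (G.i f) := by
  have hbar : Function.Involutive G.bar := G.bar_bar
  rw [← G.t_bar, ← G.sum_rho_right, ← Equiv.sum_comp hbar.toPerm]
  exact Finset.sum_congr rfl fun e _ => by
    conv_rhs => rw [← G.rho_bar_bar, G.bar_bar]
    rfl

lemma sum_rho_div (hval : ∀ x : V, 3 ≤ G.valency x) (f : E) :
    ∑ e, G.rho e f / G.k (G.t e) = 1 := by
  have hk := G.two_le_k hval (G.i f)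
  have : ∀ e, G.rho e f / G.k (G.t e) = G.rho e f / G.k (G.i f) := fun e => by
    by_cases he : G.t e = G.i f
    · rw [he]
    · simp [rho, he]
  simp_rw [this]
  rw [← Finset.sum_div, sum_rho_left, div_self (by positivity)]

/-- At a vertex of valency at least 3, some incoming edge is the inverse of neither of two
given edges. -/
lemma exists_pred_avoiding (hval : ∀ x : V, 3 ≤ G.valency x) (f g : E) :
    ∃ e, G.t e = G.i f ∧ G.bar e ≠ f ∧ G.bar e ≠ g := by
  obtain ⟨e, he, hne⟩ : ∃ e ∈ Finset.univ.filter (fun e => G.i e = G.i f),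
      e ∉ ({f, g} : Finset E) := by
    apply Finset.exists_mem_notMem_of_card_lt_card
    rw [← valency_eq_card]
    exact lt_of_le_of_lt Finset.card_le_two (hval _)
  simp only [Finset.mem_filter, Finset.mem_univ, true_and, Finset.mem_insert,
    Finset.mem_singleton, not_or] at he hne
  exact ⟨G.bar e, by rw [G.t_bar, he], by rw [G.bar_bar]; exact hne.1,
    by rw [G.bar_bar]; exact hne.2⟩

end Weights

section Entropy

variable {V E : Type} [Fintype E] [DecidableEq V] [DecidableEq E] (G : SerreGraph V E)

/-- `x` is a positive solution of the system defining the volume entropy `h` of `ℓ`. -/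
def IsPosSolution (ℓ : E → ℝ) (h : ℝ) (x : E → ℝ) : Prop :=
  (∀ e, 0 < x e) ∧ ∀ e, x e = ∑ f, G.rho e f * Real.exp (-h * ℓ f) * x f

variable {G} {ℓ x y : E → ℝ} {h h' : ℝ}

lemma IsPosSolution.le [Nonempty E] (hval : ∀ x : V, 3 ≤ G.valency x) (hℓ : ∀ e, 0 < ℓ e)
    (hx : G.IsPosSolution ℓ h x) (hy : G.IsPosSolution ℓ h' y) : h ≤ h' := by
  by_contra! hlt
  obtain ⟨e, he⟩ := Finite.exists_max fun e => x e / y e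
  have hle : ∀ f, x f ≤ x e / y e * y f := fun f => (div_le_iff₀ (hy.1 f)).1 (he f)
  have hexp : ∀ f, Real.exp (-h * ℓ f) * x f < Real.exp (-h' * ℓ f) * (x e / y e * y f) :=
    fun f => mul_lt_mul (Real.exp_lt_exp.2 (by nlinarith [hℓ f])) (hle f) (hx.1 f)
      (Real.exp_pos _).le
  have hlt' : x e < x e / y e * y e := by
    conv_lhs => rw [hx.2 e]
    have hye : x e / y e * y e
        = ∑ f, x e / y e * (G.rho e f * Real.exp (-h' * ℓ f) * y f) := by
      rw [← Finset.mul_sum, ← hy.2 e]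
    rw [hye]
    obtain ⟨f, hf₁, hf₂, -⟩ := G.exists_pred_avoiding hval (G.bar e) (G.bar e)
    refine Finset.sum_lt_sum (fun f _ => ?_) ⟨G.bar f, Finset.mem_univ _, ?_⟩
    · nlinarith [mul_le_mul_of_nonneg_left (hexp f).le (G.rho_nonneg e f)]
    · have hρ : G.rho e (G.bar f) = 1 :=
        G.rho_eq_one (by rw [G.i_bar, hf₁, G.i_bar]) (Ne.symm hf₂)
      rw [hρ]
      linarith [hexp (G.bar f)]
  rw [div_mul_cancel₀ _ (hy.1 e).ne'] at hlt'
  exact lt_irrefl _ hlt'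

/-- If `h` attains the lower bound, all terms of each equation of the system are equal. -/
lemma IsPosSolution.eq_of_attains [Fintype V] (hval : ∀ x : V, 3 ≤ G.valency x)
    (hnorm : ∑ e, ℓ e = 2) (hx : G.IsPosSolution ℓ h x)
    (hh : h = (1 / 2) * ∑ x : V, ((G.k x : ℝ) + 1) * Real.log (G.k x))
    {e f : E} (h₁ : G.t e = G.i f) (h₂ : G.bar e ≠ f) :
    G.k (G.t e) * (Real.exp (-h * ℓ f) * x f) = x e := by
  have hk : ∀ v, (0 : ℝ) < G.k v := fun v => by linarith [G.two_le_k hval v]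
  set a : E → ℝ := fun f => Real.exp (-h * ℓ f) * x f
  have ha : ∀ f, 0 < a f := fun f => mul_pos (Real.exp_pos _) (hx.1 f)
  set u : E → E → ℝ := fun e f => G.k (G.t e) * a f / x e
  have hu : ∀ e f, 0 < u e f := fun e f => div_pos (mul_pos (hk _) (ha f)) (hx.1 e)
  have hnn : ∀ e f, 0 ≤ G.rho e f / G.k (G.t e) * (u e f - 1 - Real.log (u e f)) := fun e f =>
    mul_nonneg (div_nonneg (G.rho_nonneg e f) (hk _).le)
      (by linarith [Real.log_le_sub_one_of_pos (hu e f)])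
  have hrow : ∀ e, ∑ f, G.rho e f / G.k (G.t e) = 1 := fun e => by
    rw [← Finset.sum_div, sum_rho_right, div_self (hk _).ne']
  have hlin : ∀ e, ∑ f, G.rho e f / G.k (G.t e) * u e f = 1 := fun e => by
    have : ∀ f, G.rho e f / G.k (G.t e) * u e f
        = G.rho e f * Real.exp (-h * ℓ f) * x f / x e := fun f => by
      have := (hk (G.t e)).ne'
      simp only [u, a]
      field_simp
    simp_rw [this]
    rw [← Finset.sum_div, ← hx.2 e, div_self (hx.1 e).ne']
  have hloga : ∑ f, Real.log (a f) = ∑ f, Real.log (x f) - 2 * h := by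
    have : ∀ f, Real.log (a f) = Real.log (x f) - h * ℓ f := fun f => by
      simp only [a]
      rw [Real.log_mul (Real.exp_pos _).ne' (hx.1 f).ne', Real.log_exp]
      ring
    simp_rw [this]
    rw [Finset.sum_sub_distrib, ← Finset.mul_sum, hnorm]
    ring
  have hlogu : ∀ e f, Real.log (u e f)
      = (Real.log (G.k (G.t e)) - Real.log (x e)) + Real.log (a f) := fun e f => by
    simp only [u]
    rw [Real.log_div (mul_pos (hk _) (ha f)).ne' (hx.1 e).ne',
      Real.log_mul (hk _).ne' (ha f).ne']
    ring
  have hlog : ∑ e, ∑ f, G.rho e f / G.k (G.t e) * Real.log (u e f) = 0 := by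
    simp_rw [hlogu, mul_add, Finset.sum_add_distrib, ← Finset.sum_mul, hrow, one_mul]
    rw [Finset.sum_comm]
    simp_rw [← Finset.sum_mul, G.sum_rho_div hval, one_mul]
    rw [hloga, Finset.sum_sub_distrib, G.sum_log_k hval]
    linarith
  have htot : ∑ e, ∑ f, G.rho e f / G.k (G.t e) * (u e f - 1 - Real.log (u e f)) = 0 := by
    simp_rw [mul_sub, Finset.sum_sub_distrib, hlog, hlin, mul_one, hrow]
    simp
  have hzero := (Finset.sum_eq_zero_iff_of_nonneg fun e _ =>
    Finset.sum_nonneg fun f _ => hnn e f).1 htot e (Finset.mem_univ e)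
  have hzero' := (Finset.sum_eq_zero_iff_of_nonneg fun f _ => hnn e f).1 hzero f
    (Finset.mem_univ f)
  rw [G.rho_eq_one h₁ h₂] at hzero'
  have hu1 : u e f = 1 := by
    by_contra hne
    have := Real.log_lt_sub_one_of_pos (hu e f) hne
    have hw : (0 : ℝ) < 1 / G.k (G.t e) := one_div_pos.2 (hk _)
    exact (mul_pos hw (by linarith)).ne' hzero'
  exact (div_eq_one_iff_eq (hx.1 e).ne').1 hu1

lemma IsPosSolution.two_mul_length_of_attains [Fintype V] (hval : ∀ x : V, 3 ≤ G.valency x)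
    (hℓ : G.IsLengthFunction ℓ) (hnorm : ∑ e, ℓ e = 2) (hx : G.IsPosSolution ℓ h x)
    (hh : h = (1 / 2) * ∑ x : V, ((G.k x : ℝ) + 1) * Real.log (G.k x)) (e : E) :
    2 * h * ℓ e = Real.log ((G.k (G.i e) : ℝ) * (G.k (G.t e) : ℝ)) := by
  have hk : ∀ v, (0 : ℝ) < G.k v := fun v => by linarith [G.two_le_k hval v]
  have key : ∀ {e f : E}, G.t e = G.i f →
      G.k (G.t e) * (Real.exp (-h * ℓ f) * x f) = x e := by
    intro e f hef
    obtain ⟨g, hg₁, hg₂, -⟩ := G.exists_pred_avoiding hval (G.bar e) (G.bar e)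
    rw [G.i_bar] at hg₁
    have h₁ := hx.eq_of_attains hval hnorm hh (e := e) (f := G.bar g)
      (by rw [G.i_bar, hg₁]) (Ne.symm hg₂)
    obtain ⟨c, hc, hcf, hcg⟩ := G.exists_pred_avoiding hval f (G.bar g)
    have h₂ := hx.eq_of_attains hval hnorm hh hc hcf
    have h₃ := hx.eq_of_attains hval hnorm hh (f := G.bar g)
      (by rw [G.i_bar, hg₁, hc, hef]) hcg
    rw [← h₁, mul_left_cancel₀ (hk _).ne' (h₂.trans h₃.symm)]
  have h₁ := key (e := e) (f := G.bar e) (G.i_bar e).symm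
  have h₂ := key (e := G.bar e) (f := e) (G.t_bar e)
  rw [hℓ.2] at h₁
  rw [G.t_bar] at h₂
  have hprod : (G.k (G.i e) : ℝ) * G.k (G.t e) = Real.exp (2 * h * ℓ e) := by
    have hE : Real.exp (2 * h * ℓ e) * (Real.exp (-h * ℓ e) * Real.exp (-h * ℓ e)) = 1 := by
      rw [← Real.exp_add, ← Real.exp_add, Real.exp_eq_one_iff]
      ring
    have hx0 := (hx.1 e).ne'
    have hM : (G.k (G.i e) : ℝ) * G.k (G.t e)
        * (Real.exp (-h * ℓ e) * Real.exp (-h * ℓ e)) = 1 := by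
      apply mul_right_cancel₀ hx0
      rw [← h₂] at h₁
      linear_combination h₁
    have hpos := mul_pos (Real.exp_pos (-h * ℓ e)) (Real.exp_pos (-h * ℓ e))
    exact mul_right_cancel₀ hpos.ne' (hM.trans hE.symm)
  rw [hprod, Real.log_exp]

lemma isPosSolution_sqrt_k (hval : ∀ x : V, 3 ≤ G.valency x)
    (hℓ : ∀ e, 2 * h * ℓ e = Real.log ((G.k (G.i e) : ℝ) * (G.k (G.t e) : ℝ))) :
    G.IsPosSolution ℓ h fun e => √(G.k (G.t e)) := by
  have hk : ∀ v, (0 : ℝ) < G.k v := fun v => by linarith [G.two_le_k hval v]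
  refine ⟨fun e => Real.sqrt_pos.2 (hk _), fun e => ?_⟩
  have hterm : ∀ f, Real.exp (-h * ℓ f) * √(G.k (G.t f)) = (√(G.k (G.i f)))⁻¹ := fun f => by
    have : -h * ℓ f = -(Real.log (√(G.k (G.i f))) + Real.log (√(G.k (G.t f)))) := by
      rw [Real.log_sqrt (hk _).le, Real.log_sqrt (hk _).le]
      have := hℓ f
      rw [Real.log_mul (hk _).ne' (hk _).ne'] at this
      linarith
    rw [this, ← Real.log_mul (Real.sqrt_pos.2 (hk _)).ne' (Real.sqrt_pos.2 (hk _)).ne',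
      Real.exp_neg, Real.exp_log (mul_pos (Real.sqrt_pos.2 (hk _)) (Real.sqrt_pos.2 (hk _))),
      mul_inv, mul_assoc, inv_mul_cancel₀ (Real.sqrt_pos.2 (hk _)).ne', mul_one]
  have hterm' : ∀ f, G.rho e f * Real.exp (-h * ℓ f) * √(G.k (G.t f))
      = G.rho e f * (√(G.k (G.t e)))⁻¹ := fun f => by
    rw [mul_assoc, hterm]
    by_cases he : G.t e = G.i f
    · rw [he]
    · simp [rho, he]
  simp_rw [hterm']
  rw [← Finset.sum_mul, sum_rho_right, ← div_eq_mul_inv, Real.div_sqrt]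

end Entropy

end SerreGraph

open SerreGraph in
/-- Equality case: with the hypotheses of the entropy lower bound, the entropy `h`
equals `(1/2) Σ_x (k_x + 1) log k_x` iff
`ℓ(e) = log(k_{i(e)} k_{t(e)}) / Σ_x (k_x + 1) log k_x` for every edge `e`. -/
theorem entropy_eq_min_iff
    {V E : Type} [Fintype V] [Fintype E] [DecidableEq V] [DecidableEq E]
    (G : SerreGraph V E) (hconn : G.Connected)
    (hval : ∀ x : V, 3 ≤ G.valency x)
    (ℓ : E → ℝ) (hℓ : G.IsLengthFunction ℓ) (hnorm : ∑ e : E, ℓ e = 2)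
    (h : ℝ) (hpos : 0 < h)
    (hx : ∃ x : E → ℝ, (∀ e, 0 < x e) ∧
      ∀ e : E, x e = ∑ f : E, G.rho e f * Real.exp (-h * ℓ f) * x f) :
    h = (1 / 2) * ∑ x : V, ((G.k x : ℝ) + 1) * Real.log (G.k x) ↔
      ∀ e : E, ℓ e =
        Real.log ((G.k (G.i e) : ℝ) * (G.k (G.t e) : ℝ)) /
          ∑ x : V, ((G.k x : ℝ) + 1) * Real.log (G.k x) := by
  obtain ⟨x, hx⟩ := hx
  replace hx : G.IsPosSolution ℓ h x := hx
  set S : ℝ := ∑ x : V, ((G.k x : ℝ) + 1) * Real.log (G.k x) with hS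
  constructor
  · intro hh e
    have hS2 : S = 2 * h := by linarith
    rw [← hx.two_mul_length_of_attains hval hℓ hnorm (hS ▸ hh) e, hS2,
      mul_div_cancel_left₀ _ (by positivity)]
  · intro hle
    have : Nonempty E := by
      by_contra hE
      rw [not_nonempty_iff] at hE
      simp at hnorm
    have hS0 : S ≠ 0 := by
      intro h0
      obtain ⟨e⟩ := ‹Nonempty E›
      have := hℓ.1 e
      rw [hle e, h0, div_zero] at this
      exact lt_irrefl _ this
    have hy : G.IsPosSolution ℓ (1 / 2 * S) fun e => √(G.k (G.t e)) :=
      isPosSolution_sqrt_k hval fun e => by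
        rw [hle e]
        field_simp
    exact le_antisymm (hx.le hval hℓ.1 hy) (hy.le hval hℓ.1 hx)
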